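/- No map projection sends all great-circle arcs to line segments while preserving equality of areas: there is no homeomorphism φ from a nonempty open subset U of S² (with the subspace topology) onto an open subset V of EuclideanSpace ℝ (Fin 2) such that all of the following hold: (i) for every two-dimensional linear subspace W of EuclideanSpace ℝ (Fin 3) and every connected subset σ of U ∩ W, the image φ '' σ is contained in an affine line of the plane; (ii) for every affine line L of the plane and every connected subset σ′ of V ∩ L, the preimage φ⁻¹ '' σ′ is contained in S² ∩ W′ for some two-dimensional linear subspace W′; (iii) there is a nonempty spherical cap κ₀ with closure contained in U such that for all Borel sets A, B ⊆ κ₀ with μH²(A) = μH²(B) one has vol(φ '' A) = vol(φ '' B), and for all Borel sets A′, B′ ⊆ φ '' κ₀ with vol(A′) = vol(B′) one has μH²(φ⁻¹ '' A′) = μH²(φ⁻¹ '' B′). (This is the geometric core of the theorem that no map projection preserves the convex hull compactness score ordering.) -/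

import Mathlib

open Metric MeasureTheory
open scoped RealInnerProductSpace

/-- A *spherical cap*: the set of points of the unit sphere on one (open) side of a plane
cutting through the sphere. -/
def IsSphericalCap (κ : Set (EuclideanSpace ℝ (Fin 3))) : Prop :=
  ∃ (v : EuclideanSpace ℝ (Fin 3)) (c : ℝ), ‖v‖ = 1 ∧ -1 < c ∧ c < 1 ∧
    κ = {p : EuclideanSpace ℝ (Fin 3) |
      p ∈ sphere (0 : EuclideanSpace ℝ (Fin 3)) 1 ∧ c < ⟪p, v⟫}

open NormedSpace (norm_normalize normalize_eq_self_of_norm_eq_one normalize_smul_of_pos)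

open scoped Pointwise in
/-- If two triangles on a common base `a b` have equal area and the segment joining their apices
`c` and `c'` meets the base at `m`, then `m` bisects that segment. -/
lemma eq_midpoint_of_volume_convexHull_eq {a b c c' m : EuclideanSpace ℝ (Fin 2)}
    (hm : m ∈ segment ℝ a b) (hm' : m ∈ segment ℝ c c') (habc : ¬ Collinear ℝ {a, b, c})
    (hv : volume (convexHull ℝ {a, b, c}) = volume (convexHull ℝ {a, b, c'})) :
    m = midpoint ℝ c c' := by
  have hind := affineIndependent_iff_not_collinear_set.2 habc
  rw [segment_eq_image_lineMap] at hm hm'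
  obtain ⟨r, -, rfl⟩ := hm
  obtain ⟨s, ⟨hs0, hs1⟩, hs⟩ := hm'
  set m := AffineMap.lineMap a b r with hmdef
  have hline : ∀ k : ℝ, c ≠ AffineMap.lineMap a b k := by
    rintro k rfl
    apply habc
    rw [Set.pair_comm, Set.insert_comm]
    exact collinear_insert_of_mem_affineSpan_pair (AffineMap.lineMap_mem_affineSpan_pair k a b)
  have hs0' : s ≠ 0 := by
    rintro rfl
    rw [AffineMap.lineMap_apply_zero] at hs
    exact hline r (hs.trans hmdef)
  obtain ⟨t, ht0, ht⟩ : ∃ t : ℝ, 0 ≤ t ∧ c' - m = -t • (c - m) := by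
    refine ⟨(1 - s) / s, div_nonneg (by linarith) hs0, ?_⟩
    rw [← hs, AffineMap.lineMap_apply_module]
    have : (1 - s) / s = s⁻¹ - 1 := by field_simp
    rw [this]
    ext i
    simp
    field_simp
    ring
  have hli : LinearIndependent ℝ ![b - a, c - m] := by
    rw [LinearIndependent.pair_iff]
    intro x y hxy
    by_cases hy : y = 0
    · subst hy
      refine ⟨?_, rfl⟩
      have hba : b - a ≠ 0 := by
        intro h
        apply habc
        rw [sub_eq_zero.1 h]
        simpa using collinear_pair ℝ a c
      simpa [hba] using hxy
    · exfalso
      have h2 : c - m = -(y⁻¹ * x) • (b - a) := by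
        have := congrArg (fun z => y⁻¹ • z) hxy
        simp only [smul_add, smul_smul, inv_mul_cancel₀ hy, one_smul, smul_zero] at this
        rw [neg_smul]
        exact eq_neg_of_add_eq_zero_right this
      apply hline (r - y⁻¹ * x)
      rw [sub_eq_iff_eq_add.1 h2, hmdef]
      simp only [AffineMap.lineMap_apply, vsub_eq_sub, vadd_eq_add]
      module
  let B := basisOfLinearIndependentOfCardEqFinrank hli (by simp)
  have hB0 : B 0 = b - a := by simp [B]
  have hB1 : B 1 = c - m := by simp [B]
  let f := Matrix.toLin B B (Matrix.diagonal ![1, -t])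
  have hf0 : f (b - a) = b - a := by
    rw [← hB0, Matrix.toLin_self]; simp [Fin.sum_univ_two]
  have hf1 : f (c - m) = c' - m := by
    rw [ht, ← hB1, Matrix.toLin_self]; simp [Fin.sum_univ_two]
  have hdet : LinearMap.det f = -t := by
    simp [f, LinearMap.det_toLin, Matrix.det_diagonal, Fin.prod_univ_two]
  have ham : a - m = (-r) • (b - a) := by
    simp only [hmdef, AffineMap.lineMap_apply, vsub_eq_sub, vadd_eq_add]; module
  have hbm : b - m = (1 - r) • (b - a) := by
    simp only [hmdef, AffineMap.lineMap_apply, vsub_eq_sub, vadd_eq_add]; module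
  have htrans : ∀ z : EuclideanSpace ℝ (Fin 2), volume (convexHull ℝ {a, b, z}) =
      volume (convexHull ℝ {a - m, b - m, z - m}) := by
    intro z
    have : ({a - m, b - m, z - m} : Set (EuclideanSpace ℝ (Fin 2))) =
        (-m) +ᵥ ({a, b, z} : Set (EuclideanSpace ℝ (Fin 2))) := by
      simp [Set.vadd_set_insert, sub_eq_neg_add]
    rw [this, convexHull_vadd, measure_vadd]
  have himg : convexHull ℝ ({a - m, b - m, c' - m} : Set (EuclideanSpace ℝ (Fin 2))) =
      f '' convexHull ℝ {a - m, b - m, c - m} := by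
    rw [LinearMap.image_convexHull, Set.image_insert_eq, Set.image_pair, hf1, ham, hbm, map_smul,
      map_smul, hf0]
  rw [htrans, htrans c', himg, Measure.addHaar_image_linearMap, hdet, abs_neg,
    abs_of_nonneg ht0, ← htrans] at hv
  have hpos : volume (convexHull ℝ {a, b, c}) ≠ 0 := by
    have hspan : affineSpan ℝ {a, b, c} = ⊤ := by
      have := hind.affineSpan_eq_top_iff_card_eq_finrank_add_one.2 (by simp)
      rwa [Matrix.range_cons, Matrix.range_cons_cons_empty, Set.singleton_union] at this
    have hne := interior_convexHull_nonempty_iff_affineSpan_eq_top.2 hspan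
    exact (Measure.measure_pos_of_nonempty_interior _ hne).ne'
  have hfin : volume (convexHull ℝ {a, b, c}) ≠ ⊤ :=
    ((Set.toFinite _).isCompact_convexHull ℝ).measure_lt_top.ne
  have ht1 : t = 1 := by
    have h := congrArg ENNReal.toReal hv
    rw [ENNReal.toReal_mul, ENNReal.toReal_ofReal ht0] at h
    have := ENNReal.toReal_pos hpos hfin
    exact mul_right_cancel₀ this.ne' (by linarith)
  rw [ht1] at ht
  rw [midpoint_eq_smul_add, ← sub_add_cancel c' m, ht]
  ext i
  simp
  ring

/-- A continuous injective path contained in a line traces out the segment between its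
endpoints. -/
lemma image_Icc_eq_segment {F : Type*} [NormedAddCommGroup F] [InnerProductSpace ℝ F]
    {γ : ℝ → F} (hc : ContinuousOn γ (Set.Icc 0 1)) (hi : Set.InjOn γ (Set.Icc 0 1))
    {L : AffineSubspace ℝ F} (hL : Module.finrank ℝ L.direction = 1)
    (hγ : ∀ t ∈ Set.Icc (0 : ℝ) 1, γ t ∈ L) :
    γ '' Set.Icc 0 1 = segment ℝ (γ 0) (γ 1) := by
  have h0 : (0 : ℝ) ∈ Set.Icc (0 : ℝ) 1 := by simp
  have h1 : (1 : ℝ) ∈ Set.Icc (0 : ℝ) 1 := by simp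
  set u := γ 1 - γ 0 with hu
  have hu0 : u ≠ 0 := fun h => zero_ne_one (hi h0 h1 (sub_eq_zero.1 h).symm)
  have huu : ⟪u, u⟫ ≠ 0 := inner_self_ne_zero.2 hu0
  let h : ℝ → ℝ := fun t => ⟪γ t - γ 0, u⟫ / ⟪u, u⟫
  have hγh : ∀ t ∈ Set.Icc (0 : ℝ) 1, γ t = AffineMap.lineMap (γ 0) (γ 1) (h t) := by
    intro t ht
    have hud : (⟨u, AffineSubspace.vsub_mem_direction (hγ 1 h1) (hγ 0 h0)⟩ : L.direction) ≠ 0 := by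
      simpa [Subtype.ext_iff] using hu0
    obtain ⟨r, hr⟩ := (finrank_eq_one_iff_of_nonzero' _ hud).1 hL
      ⟨γ t - γ 0, AffineSubspace.vsub_mem_direction (hγ t ht) (hγ 0 h0)⟩
    have hr' : r • u = γ t - γ 0 := congrArg Subtype.val hr
    have : h t = r := by
      simp only [h]
      rw [← hr', real_inner_smul_left, mul_div_assoc, div_self huu, mul_one]
    rw [this, AffineMap.lineMap_apply, vsub_eq_sub, vadd_eq_add, ← hu, hr', sub_add_cancel]
  have hh0 : h 0 = 0 := by simp [h]
  have hh1 : h 1 = 1 := div_self huu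
  have hhc : ContinuousOn h (Set.Icc 0 1) := by
    simp only [h]; fun_prop
  have hhi : Set.InjOn h (Set.Icc 0 1) := by
    intro s hs t ht hst
    exact hi hs ht (by rw [hγh s hs, hγh t ht, hst])
  have hmono := hhc.strictMonoOn_of_injOn_Icc zero_le_one (by simp [hh0, hh1]) hhi
  have himg : h '' Set.Icc 0 1 = Set.Icc 0 1 := by
    apply Set.Subset.antisymm
    · rintro _ ⟨t, ht, rfl⟩
      exact ⟨hh0 ▸ hmono.monotoneOn h0 ht ht.1, hh1 ▸ hmono.monotoneOn ht h1 ht.2⟩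
    · have := intermediate_value_Icc zero_le_one hhc
      rwa [hh0, hh1] at this
  rw [segment_eq_image_lineMap, Set.image_congr hγh, ← Set.image_image, himg]

section Cap

variable {E : Type*} [NormedAddCommGroup E] [InnerProductSpace ℝ E]

/-- The cap of the unit sphere cut out by the half-space `c < ⟪p, v⟫`. -/
def sphericalCap (v : E) (c : ℝ) : Set E := {p | ‖p‖ = 1 ∧ c < ⟪p, v⟫}

/-- The shorter great-circle arc joining two non-antipodal unit vectors. -/
def sphericalArc (x y : E) : Set E := NormedSpace.normalize '' segment ℝ x y

/-- The spherical triangle with the given vertices, swept out by the arcs from `z` to the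
opposite side. -/
def sphericalTriangle (x y z : E) : Set E := ⋃ d ∈ sphericalArc x y, sphericalArc z d

lemma sphericalArc_symm (x y : E) : sphericalArc x y = sphericalArc y x := by
  rw [sphericalArc, segment_symm, sphericalArc]

lemma LinearIsometryEquiv.image_sphericalArc (e : E ≃ₗᵢ[ℝ] E) (x y : E) :
    e '' sphericalArc x y = sphericalArc (e x) (e y) := by
  have h := image_segment ℝ (e.toLinearEquiv.toLinearMap.toAffineMap) x y
  simp only [LinearMap.coe_toAffineMap, LinearEquiv.coe_coe, LinearIsometryEquiv.coe_toLinearEquiv]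
    at h
  rw [sphericalArc, sphericalArc, ← h, Set.image_image, Set.image_image]
  refine Set.image_congr fun z _ => ?_
  simp [NormedSpace.normalize]

lemma LinearIsometryEquiv.image_sphericalTriangle (e : E ≃ₗᵢ[ℝ] E) (x y z : E) :
    e '' sphericalTriangle x y z = sphericalTriangle (e x) (e y) (e z) := by
  simp only [sphericalTriangle, Set.image_iUnion, image_sphericalArc]
  rw [← image_sphericalArc, Set.biUnion_image]

lemma exists_nonneg_of_mem_sphericalArc {x y z : E} (h : z ∈ sphericalArc x y) :
    ∃ s t : ℝ, 0 ≤ s ∧ 0 ≤ t ∧ z = s • x + t • y := by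
  obtain ⟨_, ⟨s, t, hs, ht, -, rfl⟩, rfl⟩ := h
  exact ⟨_, _, mul_nonneg (inv_nonneg.2 (norm_nonneg (s • x + t • y))) hs,
    mul_nonneg (inv_nonneg.2 (norm_nonneg (s • x + t • y))) ht, by
      simp only [NormedSpace.normalize, smul_add, smul_smul]⟩

lemma normalize_add_mem_sphericalArc (x y : E) : NormedSpace.normalize (x + y) ∈ sphericalArc x y :=
  ⟨(2⁻¹ : ℝ) • (x + y), ⟨2⁻¹, 2⁻¹, by norm_num, by norm_num, by norm_num, by simp⟩,
    normalize_smul_of_pos (by norm_num) _⟩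

variable {v : E} {c : ℝ} {x y z : E}

lemma lt_inner_of_mem_segment (hx : x ∈ sphericalCap v c) (hy : y ∈ sphericalCap v c)
    (hz : z ∈ segment ℝ x y) : c < ⟪z, v⟫ := by
  have hconv : Convex ℝ {p : E | c < ⟪p, v⟫} := by
    have := convex_halfSpace_gt (𝕜 := ℝ) (f := fun p : E => ⟪p, v⟫)
      (IsLinearMap.mk (fun _ _ => inner_add_left _ _ _)
        (fun _ _ => by simp [real_inner_smul_left])) c
    exact this
  exact hconv.segment_subset hx.2 hy.2 hz

lemma ne_zero_of_mem_segment (hc : 0 ≤ c) (hx : x ∈ sphericalCap v c)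
    (hy : y ∈ sphericalCap v c) (hz : z ∈ segment ℝ x y) : z ≠ 0 := by
  rintro rfl
  have := lt_inner_of_mem_segment hx hy hz
  rw [inner_zero_left] at this
  linarith

lemma sphericalArc_subset_sphericalCap (hc : 0 ≤ c) (hx : x ∈ sphericalCap v c)
    (hy : y ∈ sphericalCap v c) : sphericalArc x y ⊆ sphericalCap v c := by
  rintro _ ⟨z, hz, rfl⟩
  have hz0 := ne_zero_of_mem_segment hc hx hy hz
  refine ⟨norm_normalize hz0, ?_⟩
  have h1 := lt_inner_of_mem_segment hx hy hz
  have h2 : ‖z‖ ≤ 1 := by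
    have := (convex_closedBall (0 : E) 1).segment_subset (x := x) (y := y)
      (by simp [hx.1]) (by simp [hy.1]) hz
    simpa using this
  rw [NormedSpace.normalize, real_inner_smul_left]
  have h3 : 1 ≤ ‖z‖⁻¹ := (one_le_inv₀ (norm_pos_iff.2 hz0)).2 h2
  nlinarith

lemma linearIndependent_pair_of_mem_sphericalCap (hc : 0 ≤ c) (hx : x ∈ sphericalCap v c)
    (hy : y ∈ sphericalCap v c) (hxy : x ≠ y) : LinearIndependent ℝ ![x, y] := by
  have hx0 : x ≠ 0 := norm_ne_zero_iff.1 (by rw [hx.1]; exact one_ne_zero)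
  rw [LinearIndependent.pair_iff' hx0]
  rintro a rfl
  have h1 := hy.1
  rw [norm_smul, hx.1, mul_one, Real.norm_eq_abs] at h1
  have h2 := hy.2
  rw [real_inner_smul_left] at h2
  have h3 := hx.2
  rcases eq_or_eq_neg_of_abs_eq h1 with rfl | rfl
  · simp at hxy
  · linarith

lemma injOn_normalize_lineMap (hc : 0 ≤ c) (hx : x ∈ sphericalCap v c)
    (hy : y ∈ sphericalCap v c) (hxy : x ≠ y) :
    Set.InjOn (fun t : ℝ => NormedSpace.normalize (AffineMap.lineMap x y t)) (Set.Icc 0 1) := by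
  intro s hs t ht hst
  have hli := LinearIndependent.pair_iff.1 (linearIndependent_pair_of_mem_sphericalCap hc hx hy hxy)
  have hmem : ∀ r ∈ Set.Icc (0 : ℝ) 1, AffineMap.lineMap x y r ∈ segment ℝ x y := fun r hr => by
    rw [segment_eq_image_lineMap]; exact ⟨r, hr, rfl⟩
  have hs0 := norm_pos_iff.2 (ne_zero_of_mem_segment hc hx hy (hmem s hs))
  simp only [NormedSpace.normalize, AffineMap.lineMap_apply_module] at hst hs0
  set p := ‖(1 - s) • x + s • y‖⁻¹ with hp
  set q := ‖(1 - t) • x + t • y‖⁻¹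
  have hp0 : p ≠ 0 := (inv_pos.2 hs0).ne'
  obtain ⟨h1, h2⟩ := hli (p * (1 - s) - q * (1 - t)) (p * s - q * t) (by
    rw [← sub_eq_zero] at hst
    rw [← hst]
    module)
  have hpq : p = q := by linarith
  rw [← hpq] at h2
  exact mul_left_cancel₀ hp0 (by linarith)

lemma continuousOn_normalize_segment (hc : 0 ≤ c) (hx : x ∈ sphericalCap v c)
    (hy : y ∈ sphericalCap v c) : ContinuousOn (NormedSpace.normalize : E → E) (segment ℝ x y) := by
  unfold NormedSpace.normalize
  exact (continuousOn_id.norm.inv₀ fun z hz =>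
    norm_ne_zero_iff.2 (ne_zero_of_mem_segment hc hx hy hz)).smul continuousOn_id

lemma isConnected_sphericalArc (hc : 0 ≤ c) (hx : x ∈ sphericalCap v c)
    (hy : y ∈ sphericalCap v c) : IsConnected (sphericalArc x y) :=
  ((convex_segment x y).isConnected ⟨x, left_mem_segment ℝ x y⟩).image _
    (continuousOn_normalize_segment hc hx hy)

/-- Points of the sphere near a point of the cap belong to the cap. -/
lemma eventually_normalize_add_smul_mem (hx : x ∈ sphericalCap v c) (w : E) :
    ∀ᶠ ε : ℝ in nhds 0, NormedSpace.normalize (x + ε • w) ∈ sphericalCap v c := by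
  have hx0 : x ≠ 0 := norm_ne_zero_iff.1 (by rw [hx.1]; exact one_ne_zero)
  have hne : ∀ᶠ ε : ℝ in nhds 0, x + ε • w ≠ 0 := by
    have : ContinuousAt (fun ε : ℝ => x + ε • w) 0 := by fun_prop
    exact this.eventually_ne (by simpa using hx0)
  have hlt : ∀ᶠ ε : ℝ in nhds 0, c < ⟪NormedSpace.normalize (x + ε • w), v⟫ := by
    have : ContinuousAt (fun ε : ℝ => ⟪NormedSpace.normalize (x + ε • w), v⟫) 0 := by
      unfold NormedSpace.normalize
      refine ContinuousAt.inner (𝕜 := ℝ) (ContinuousAt.smul (ContinuousAt.inv₀ (by fun_prop) ?_)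
        (by fun_prop)) continuousAt_const
      simpa using hx0
    refine this.eventually_const_lt ?_
    simpa [normalize_eq_self_of_norm_eq_one hx.1] using hx.2
  filter_upwards [hne, hlt] with ε h1 h2
  exact ⟨norm_normalize h1, h2⟩

lemma exists_pos_normalize_add_smul_mem (hx : x ∈ sphericalCap v c) (w w' : E) :
    ∃ ε : ℝ, 0 < ε ∧ NormedSpace.normalize (x + ε • w) ∈ sphericalCap v c ∧
      NormedSpace.normalize (x + ε • w') ∈ sphericalCap v c := by
  have h := ((eventually_normalize_add_smul_mem hx w).and
    (eventually_normalize_add_smul_mem hx w')).filter_mono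
      (nhdsWithin_le_nhds (s := Set.Ioi (0 : ℝ)))
  obtain ⟨ε, h1, h2⟩ := (h.and self_mem_nhdsWithin).exists
  exact ⟨ε, h2, h1⟩

/-- The half-turn about the spherical midpoint of two unit vectors exchanges them. -/
lemma reflection_normalize_add (hx : ‖x‖ = 1) (hy : ‖y‖ = 1) (hxy : x + y ≠ 0) :
    (ℝ ∙ NormedSpace.normalize (x + y)).reflection x = y := by
  rw [Submodule.reflection_singleton_apply, norm_normalize hxy, NormedSpace.normalize,
    real_inner_smul_left, inner_add_left, real_inner_self_eq_norm_sq, hx]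
  have hn : ‖x + y‖ ^ 2 = 2 * (1 + ⟪y, x⟫) := by
    rw [norm_add_sq_real, hx, hy, real_inner_comm]; ring
  have hn0 : ‖x + y‖ ≠ 0 := norm_ne_zero_iff.2 hxy
  have : (2 : ℝ) * (‖x + y‖⁻¹ * (1 + ⟪y, x⟫)) * ‖x + y‖⁻¹ = 1 := by
    field_simp
    linarith
  simp only [RCLike.ofReal_real_eq_id, id, one_pow, div_one]
  rw [← Nat.cast_smul_eq_nsmul ℝ, smul_smul, smul_smul]
  push_cast
  rw [this, one_smul, add_sub_cancel_left]

end Cap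

lemma exists_norm_eq_one_orthogonal_pair (x y : EuclideanSpace ℝ (Fin 3)) :
    ∃ w : EuclideanSpace ℝ (Fin 3), ‖w‖ = 1 ∧ ⟪x, w⟫ = 0 ∧ ⟪y, w⟫ = 0 := by
  have hle : Module.finrank ℝ (Submodule.span ℝ ({x, y} : Set (EuclideanSpace ℝ (Fin 3)))) ≤ 2 := by
    classical
    have := finrank_span_finset_le_card (R := ℝ) ({x, y} : Finset (EuclideanSpace ℝ (Fin 3)))
    simp only [Finset.coe_insert, Finset.coe_singleton] at this
    exact this.trans Finset.card_le_two
  have hne : (Submodule.span ℝ ({x, y} : Set (EuclideanSpace ℝ (Fin 3))))ᗮ ≠ ⊥ := by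
    intro h
    have h2 := Submodule.finrank_add_finrank_orthogonal
      (Submodule.span ℝ ({x, y} : Set (EuclideanSpace ℝ (Fin 3))))
    rw [h] at h2
    simp at h2
    omega
  obtain ⟨w, hw, hw0⟩ := Submodule.exists_mem_ne_zero_of_ne_bot hne
  rw [Submodule.mem_orthogonal] at hw
  refine ⟨NormedSpace.normalize w, norm_normalize hw0, ?_, ?_⟩ <;>
    rw [NormedSpace.normalize, real_inner_smul_right, hw _ (Submodule.subset_span (by simp)), mul_zero]

section Projection

variable {v : EuclideanSpace ℝ (Fin 3)} {c : ℝ}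
  {φ : EuclideanSpace ℝ (Fin 3) → EuclideanSpace ℝ (Fin 2)}

/-- A map is *geodesic* on a set if it sends connected subsets of great circles into lines. -/
def IsGeodesicOn (φ : EuclideanSpace ℝ (Fin 3) → EuclideanSpace ℝ (Fin 2))
    (K : Set (EuclideanSpace ℝ (Fin 3))) : Prop :=
  ∀ W : Submodule ℝ (EuclideanSpace ℝ (Fin 3)), Module.finrank ℝ W = 2 →
    ∀ σ : Set (EuclideanSpace ℝ (Fin 3)), IsConnected σ →
      σ ⊆ K ∩ (W : Set (EuclideanSpace ℝ (Fin 3))) →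
      ∃ L : AffineSubspace ℝ (EuclideanSpace ℝ (Fin 2)),
        Module.finrank ℝ L.direction = 1 ∧ φ '' σ ⊆ (L : Set (EuclideanSpace ℝ (Fin 2)))

variable {x y z : EuclideanSpace ℝ (Fin 3)}

lemma IsGeodesicOn.image_sphericalArc (hφ : IsGeodesicOn φ (sphericalCap v c)) (hc : 0 ≤ c)
    (hcont : ContinuousOn φ (sphericalCap v c)) (hinj : Set.InjOn φ (sphericalCap v c))
    (hx : x ∈ sphericalCap v c) (hy : y ∈ sphericalCap v c) :
    φ '' sphericalArc x y = segment ℝ (φ x) (φ y) := by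
  rcases eq_or_ne x y with rfl | hxy
  · simp [sphericalArc, segment_same, normalize_eq_self_of_norm_eq_one hx.1]
  have hW : Module.finrank ℝ (Submodule.span ℝ (Set.range ![x, y])) = 2 := by
    simpa using finrank_span_eq_card (linearIndependent_pair_of_mem_sphericalCap hc hx hy hxy)
  have hsub := sphericalArc_subset_sphericalCap hc hx hy
  obtain ⟨L, hL, hσ⟩ := hφ _ hW _ (isConnected_sphericalArc hc hx hy)
    (Set.subset_inter hsub fun p hp => by
      obtain ⟨s, t, -, -, rfl⟩ := exists_nonneg_of_mem_sphericalArc hp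
      exact add_mem (Submodule.smul_mem _ _ (Submodule.subset_span ⟨0, rfl⟩))
        (Submodule.smul_mem _ _ (Submodule.subset_span ⟨1, rfl⟩)))
  let γ : ℝ → EuclideanSpace ℝ (Fin 3) :=
    fun t => NormedSpace.normalize (AffineMap.lineMap x y t)
  have harc : γ '' Set.Icc 0 1 = sphericalArc x y := by
    rw [sphericalArc, segment_eq_image_lineMap, Set.image_image]
  have hγc : ContinuousOn γ (Set.Icc 0 1) := by
    refine (continuousOn_normalize_segment hc hx hy).comp
      (AffineMap.lineMap_continuous.continuousOn) fun t ht => ?_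
    rw [segment_eq_image_lineMap]
    exact ⟨t, ht, rfl⟩
  have hmaps : Set.MapsTo γ (Set.Icc 0 1) (sphericalCap v c) := fun t ht =>
    hsub (harc ▸ Set.mem_image_of_mem γ ht)
  have hγ0 : γ 0 = x := by simp [γ, normalize_eq_self_of_norm_eq_one hx.1]
  have hγ1 : γ 1 = y := by simp [γ, normalize_eq_self_of_norm_eq_one hy.1]
  have := image_Icc_eq_segment (γ := φ ∘ γ) (hcont.comp hγc hmaps)
    (hinj.comp (injOn_normalize_lineMap hc hx hy hxy) hmaps) hL fun t ht =>
      hσ ⟨γ t, harc ▸ Set.mem_image_of_mem γ ht, rfl⟩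
  rwa [Set.image_comp, harc, Function.comp_apply, Function.comp_apply, hγ0, hγ1] at this

lemma sphericalTriangle_subset_sphericalCap (hc : 0 ≤ c) (hx : x ∈ sphericalCap v c)
    (hy : y ∈ sphericalCap v c) (hz : z ∈ sphericalCap v c) :
    sphericalTriangle x y z ⊆ sphericalCap v c :=
  Set.iUnion₂_subset fun _ hd => sphericalArc_subset_sphericalCap hc hz
    (sphericalArc_subset_sphericalCap hc hx hy hd)

lemma IsGeodesicOn.image_sphericalTriangle (hφ : IsGeodesicOn φ (sphericalCap v c)) (hc : 0 ≤ c)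
    (hcont : ContinuousOn φ (sphericalCap v c)) (hinj : Set.InjOn φ (sphericalCap v c))
    (hx : x ∈ sphericalCap v c) (hy : y ∈ sphericalCap v c) (hz : z ∈ sphericalCap v c) :
    φ '' sphericalTriangle x y z = convexHull ℝ {φ x, φ y, φ z} := by
  have hperm : ({φ x, φ y, φ z} : Set (EuclideanSpace ℝ (Fin 2))) = {φ z, φ x, φ y} := by
    rw [Set.pair_comm (φ y), Set.insert_comm]
  rw [hperm, convexHull_insert (Set.insert_nonempty _ _), convexHull_pair, convexJoin_singleton_left,
    ← hφ.image_sphericalArc hc hcont hinj hx hy, Set.biUnion_image, sphericalTriangle,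
    Set.image_iUnion₂]
  exact Set.iUnion₂_congr fun d hd => hφ.image_sphericalArc hc hcont hinj hz
    (sphericalArc_subset_sphericalCap hc hx hy hd)

lemma IsGeodesicOn.mem_sphericalArc_of_wbtw (hφ : IsGeodesicOn φ (sphericalCap v c)) (hc : 0 ≤ c)
    (hcont : ContinuousOn φ (sphericalCap v c)) (hinj : Set.InjOn φ (sphericalCap v c))
    (hx : x ∈ sphericalCap v c) (hy : y ∈ sphericalCap v c) (hz : z ∈ sphericalCap v c)
    (h : Wbtw ℝ (φ x) (φ y) (φ z)) : y ∈ sphericalArc x z := by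
  rw [← mem_segment_iff_wbtw, ← hφ.image_sphericalArc hc hcont hinj hx hz] at h
  obtain ⟨p, hp, hpy⟩ := h
  rwa [← hinj (sphericalArc_subset_sphericalCap hc hx hz hp) hy hpy]

/-- A geodesic map respecting equality of areas sends spherical midpoints to midpoints. -/
lemma IsGeodesicOn.map_normalize_add (hφ : IsGeodesicOn φ (sphericalCap v c)) (hc : 0 ≤ c)
    (hcont : ContinuousOn φ (sphericalCap v c)) (hinj : Set.InjOn φ (sphericalCap v c))
    (harea : ∀ x y z x' y' z', x ∈ sphericalCap v c → y ∈ sphericalCap v c →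
      z ∈ sphericalCap v c → x' ∈ sphericalCap v c → y' ∈ sphericalCap v c →
      z' ∈ sphericalCap v c → μH[2] (sphericalTriangle x y z) = μH[2] (sphericalTriangle x' y' z') →
      volume (φ '' sphericalTriangle x y z) = volume (φ '' sphericalTriangle x' y' z'))
    (hx : x ∈ sphericalCap v c) (hy : y ∈ sphericalCap v c) :
    φ (NormedSpace.normalize (x + y)) = midpoint ℝ (φ x) (φ y) := by
  rcases eq_or_ne x y with rfl | hxy
  · rw [midpoint_self, ← two_smul ℝ x, normalize_smul_of_pos two_pos,
      normalize_eq_self_of_norm_eq_one hx.1]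
  have hm := sphericalArc_subset_sphericalCap hc hx hy (normalize_add_mem_sphericalArc x y)
  have hxy0 : x + y ≠ 0 := fun h => by
    have := hm.1
    simp [h] at this
  have href := reflection_normalize_add hx.1 hy.1 hxy0
  have hmarc := normalize_add_mem_sphericalArc x y
  set m := NormedSpace.normalize (x + y) with hmdef
  obtain ⟨w, hw, hmw, hxw⟩ := exists_norm_eq_one_orthogonal_pair m x
  obtain ⟨ε, hε, ha, hb⟩ := exists_pos_normalize_add_smul_mem hm w (-w)
  set H := (ℝ ∙ m).reflection with hH
  have hHm : H m = m := (Submodule.reflection_eq_self_iff m).2 (Submodule.mem_span_singleton_self m)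
  have hHw : H w = -w := by
    rw [hH, Submodule.reflection_singleton_apply, hmw]; simp
  have hHn : ∀ u, H (NormedSpace.normalize u) = NormedSpace.normalize (H u) := fun u => by
    simp [NormedSpace.normalize]
  have hHa : H (NormedSpace.normalize (m + ε • w)) = NormedSpace.normalize (m + ε • -w) := by
    rw [hHn, map_add, map_smul, hHm, hHw]
  have hHb : H (NormedSpace.normalize (m + ε • -w)) = NormedSpace.normalize (m + ε • w) := by
    rw [hHn, map_add, map_smul, map_neg, hHm, hHw, neg_neg]
  have hr0 : ‖m + ε • -w‖ = ‖m + ε • w‖ := by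
    rw [← H.norm_map (m + ε • w), map_add, map_smul, hHm, hHw]
  have hr : 0 < ‖m + ε • w‖⁻¹ := by
    refine inv_pos.2 (norm_pos_iff.2 fun h => ?_)
    have := ha.1
    simp [h] at this
  have haw : ⟪NormedSpace.normalize (m + ε • w), w⟫ = ‖m + ε • w‖⁻¹ * ε := by
    simp [NormedSpace.normalize, real_inner_smul_left, inner_add_left, hmw, hw]
  have hbw : ⟪NormedSpace.normalize (m + ε • -w), w⟫ = -(‖m + ε • w‖⁻¹ * ε) := by
    rw [NormedSpace.normalize, hr0]
    simp [real_inner_smul_left, inner_add_left, hmw, hw]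
  have hab : NormedSpace.normalize (m + ε • w) + NormedSpace.normalize (m + ε • -w) =
      (2 * ‖m + ε • w‖⁻¹) • m := by
    simp only [NormedSpace.normalize, hr0]; module
  have hrε := mul_pos hr hε
  set a := NormedSpace.normalize (m + ε • w)
  set b := NormedSpace.normalize (m + ε • -w)
  have hmab : m ∈ sphericalArc a b := by
    have := normalize_add_mem_sphericalArc a b
    rwa [hab, normalize_smul_of_pos (by positivity), normalize_eq_self_of_norm_eq_one hm.1] at this
  refine eq_midpoint_of_volume_convexHull_eq (a := φ a) (b := φ b) ?_ ?_ ?_ ?_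
  · rw [← hφ.image_sphericalArc hc hcont hinj ha hb]
    exact Set.mem_image_of_mem φ hmab
  · rw [← hφ.image_sphericalArc hc hcont hinj hx hy]
    exact Set.mem_image_of_mem φ hmarc
  · intro hcol
    rcases hcol.wbtw_or_wbtw_or_wbtw with h | h | h
    · obtain ⟨s, t, hs, ht, h⟩ := exists_nonneg_of_mem_sphericalArc
        (hφ.mem_sphericalArc_of_wbtw hc hcont hinj ha hb hx h)
      have h2 := congrArg (fun p => ⟪p, w⟫) h
      simp only [inner_add_left, real_inner_smul_left, haw, hbw, hxw] at h2
      nlinarith [mul_nonneg hs hrε.le]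
    · obtain ⟨s, t, hs, ht, h⟩ := exists_nonneg_of_mem_sphericalArc
        (hφ.mem_sphericalArc_of_wbtw hc hcont hinj hb hx ha h)
      have h2 := congrArg (fun p => ⟪p, w⟫) h
      simp only [inner_add_left, real_inner_smul_left, haw, hbw, hxw] at h2
      have hst : s = t := by
        have : (t - s) * (‖m + ε • w‖⁻¹ * ε) = 0 := by linarith
        rcases mul_eq_zero.1 this with h | h <;> linarith
      rw [hst, ← smul_add, add_comm b a, hab, smul_smul] at h
      apply hxy
      rw [← href, h, map_smul, hHm]
    · obtain ⟨s, t, hs, ht, h⟩ := exists_nonneg_of_mem_sphericalArc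
        (hφ.mem_sphericalArc_of_wbtw hc hcont hinj hx ha hb h)
      have h2 := congrArg (fun p => ⟪p, w⟫) h
      simp only [inner_add_left, real_inner_smul_left, haw, hbw, hxw] at h2
      nlinarith [mul_nonneg ht hrε.le]
  · rw [← hφ.image_sphericalTriangle hc hcont hinj ha hb hx,
      ← hφ.image_sphericalTriangle hc hcont hinj ha hb hy]
    refine harea _ _ _ _ _ _ ha hb hx ha hb hy ?_
    have himg := H.image_sphericalTriangle a b x
    rw [hHa, hHb, href] at himg
    have hsymm : sphericalTriangle b a y = sphericalTriangle a b y := by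
      rw [sphericalTriangle, sphericalArc_symm, sphericalTriangle]
    rw [← hsymm, ← himg, H.isometry.hausdorffMeasure_image (Or.inr H.surjective)]

/-- No injective map of a spherical cap to the plane sends spherical midpoints to midpoints. -/
lemma not_forall_map_normalize_add_eq_midpoint (hv : ‖v‖ = 1) (hc : 0 ≤ c) (hc1 : c < 1)
    (hinj : Set.InjOn φ (sphericalCap v c)) :
    ¬ ∀ x ∈ sphericalCap v c, ∀ y ∈ sphericalCap v c,
      φ (NormedSpace.normalize (x + y)) = midpoint ℝ (φ x) (φ y) := by
  intro hmid
  have ha : v ∈ sphericalCap v c := ⟨hv, by simpa [hv] using hc1⟩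
  obtain ⟨w, hw, hvw, -⟩ := exists_norm_eq_one_orthogonal_pair v v
  obtain ⟨w', hw', hvw', hww'⟩ := exists_norm_eq_one_orthogonal_pair v w
  obtain ⟨ε, hε, hb, hd⟩ := exists_pos_normalize_add_smul_mem ha w w'
  have hcap : ∀ {x y}, x ∈ sphericalCap v c → y ∈ sphericalCap v c →
      NormedSpace.normalize (x + y) ∈ sphericalCap v c := fun hx hy =>
    sphericalArc_subset_sphericalCap hc hx hy (normalize_add_mem_sphericalArc _ _)
  obtain ⟨p, hp, hbp⟩ : ∃ p : ℝ, 0 < p ∧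
      NormedSpace.normalize (v + ε • w) = p • (v + ε • w) := by
    refine ⟨_, inv_pos.2 (norm_pos_iff.2 fun h => ?_), rfl⟩
    have := hb.1
    simp [h] at this
  obtain ⟨q, hq, hdq⟩ : ∃ q : ℝ, 0 < q ∧
      NormedSpace.normalize (v + ε • w') = q • (v + ε • w') := by
    refine ⟨_, inv_pos.2 (norm_pos_iff.2 fun h => ?_), rfl⟩
    have := hd.1
    simp [h] at this
  rw [hbp] at hb
  rw [hdq] at hd
  set b := p • (v + ε • w) with hbdef
  set d := q • (v + ε • w') with hddef
  have heq : NormedSpace.normalize (NormedSpace.normalize (v + b) + NormedSpace.normalize (b + d)) =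
      NormedSpace.normalize (b + NormedSpace.normalize (v + d)) := by
    apply hinj (hcap (hcap ha hb) (hcap hb hd)) (hcap hb (hcap ha hd))
    rw [hmid _ (hcap ha hb) _ (hcap hb hd), hmid _ ha _ hb, hmid _ hb _ hd,
      hmid _ hb _ (hcap ha hd), hmid _ ha _ hd]
    simp only [midpoint_eq_smul_add, invOf_eq_inv]
    module
  have hpos : ∀ {x y}, x ∈ sphericalCap v c → y ∈ sphericalCap v c → 0 < ‖x + y‖⁻¹ :=
    fun {x y} hx hy => by
      refine inv_pos.2 (norm_pos_iff.2 fun h => ?_)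
      have := (hcap hx hy).1
      simp [h] at this
  have hn1 := hpos (hcap ha hb) (hcap hb hd)
  have hn2 := hpos hb (hcap ha hd)
  have hα := hpos ha hb
  have hβ := hpos hb hd
  have hδ := hpos ha hd
  have hnorm : ‖v + d‖⁻¹ = 1 / 2 := by
    simp only [NormedSpace.normalize] at heq hn1 hn2
    set α := ‖v + b‖⁻¹
    set β := ‖b + d‖⁻¹
    set δ := ‖v + d‖⁻¹
    set r := ‖α • (v + b) + β • (b + d)‖⁻¹
    set s := ‖b + δ • (v + d)‖⁻¹
    have hw'w : ⟪w', w⟫ = 0 := by rw [real_inner_comm]; exact hww'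
    have hwv : ⟪w, v⟫ = 0 := by rw [real_inner_comm]; exact hvw
    have hw'v : ⟪w', v⟫ = 0 := by rw [real_inner_comm]; exact hvw'
    have e1 := congrArg (fun z => ⟪z, w⟫) heq
    have e2 := congrArg (fun z => ⟪z, w'⟫) heq
    have e3 := congrArg (fun z => ⟪z, v⟫) heq
    simp only [hbdef, hddef, inner_add_left, real_inner_smul_left, hvw, hvw', hww', hw'w, hwv,
      hw'v, real_inner_self_eq_norm_sq, hv, hw, hw'] at e1 e2 e3
    have f1 : r * (α + β) = s := by
      have : p * ε ≠ 0 := by positivity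
      apply mul_left_cancel₀ this
      linarith
    have f2 : r * β = s * δ := by
      have : q * ε ≠ 0 := by positivity
      apply mul_left_cancel₀ this
      linarith
    have f3 : r * α = s * δ := by
      linear_combination e3 - p * f1 - q * f2
    apply mul_left_cancel₀ hn2.ne'
    linarith
  have hn : ‖v + d‖ = 2 := by
    have := inv_inv ‖v + d‖
    rw [hnorm] at this
    linarith
  have hvd : v = d := by
    have h1 := parallelogram_law_with_norm ℝ v d
    rw [hn, hv, hd.1] at h1
    have h2 : ‖v - d‖ = 0 := by nlinarith [norm_nonneg (v - d)]
    exact sub_eq_zero.1 (norm_eq_zero.1 h2)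
  have h3 := congrArg (fun z => ⟪z, w'⟫) hvd
  simp only [hddef, inner_add_left, real_inner_smul_left, hvw', real_inner_self_eq_norm_sq, hw'] at h3
  have : 0 < q * ε := mul_pos hq hε
  linarith

end Projection


/-- No map projection sends all great-circle arcs to line segments while preserving
equality of areas. -/
theorem no_geodesic_area_preserving_projection :
    ¬ ∃ (U : Set (EuclideanSpace ℝ (Fin 3))) (V : Set (EuclideanSpace ℝ (Fin 2)))
        (φ : EuclideanSpace ℝ (Fin 3) → EuclideanSpace ℝ (Fin 2))
        (ψ : EuclideanSpace ℝ (Fin 2) → EuclideanSpace ℝ (Fin 3)),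
      U.Nonempty ∧
      (∃ G : Set (EuclideanSpace ℝ (Fin 3)), IsOpen G ∧
        U = sphere (0 : EuclideanSpace ℝ (Fin 3)) 1 ∩ G) ∧
      IsOpen V ∧ φ '' U = V ∧ ψ '' V = U ∧
      ContinuousOn φ U ∧ ContinuousOn ψ V ∧
      (∀ p ∈ U, ψ (φ p) = p) ∧ (∀ q ∈ V, φ (ψ q) = q) ∧
      -- (i) great-circle arcs are sent into affine lines
      (∀ W : Submodule ℝ (EuclideanSpace ℝ (Fin 3)), Module.finrank ℝ W = 2 →
        ∀ σ : Set (EuclideanSpace ℝ (Fin 3)), IsConnected σ →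
          σ ⊆ U ∩ (W : Set (EuclideanSpace ℝ (Fin 3))) →
          ∃ L : AffineSubspace ℝ (EuclideanSpace ℝ (Fin 2)),
            Module.finrank ℝ L.direction = 1 ∧
            φ '' σ ⊆ (L : Set (EuclideanSpace ℝ (Fin 2)))) ∧
      -- (ii) connected subsets of affine lines are sent into great circles
      (∀ L : AffineSubspace ℝ (EuclideanSpace ℝ (Fin 2)),
        Module.finrank ℝ L.direction = 1 →
        ∀ σ' : Set (EuclideanSpace ℝ (Fin 2)), IsConnected σ' →
          σ' ⊆ V ∩ (L : Set (EuclideanSpace ℝ (Fin 2))) →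
          ∃ W' : Submodule ℝ (EuclideanSpace ℝ (Fin 3)), Module.finrank ℝ W' = 2 ∧
            ψ '' σ' ⊆ sphere (0 : EuclideanSpace ℝ (Fin 3)) 1 ∩
              (W' : Set (EuclideanSpace ℝ (Fin 3)))) ∧
      -- (iii) equality of areas is preserved inside some cap
      (∃ κ₀ : Set (EuclideanSpace ℝ (Fin 3)), IsSphericalCap κ₀ ∧ κ₀.Nonempty ∧
        closure κ₀ ⊆ U ∧
        (∀ A B : Set (EuclideanSpace ℝ (Fin 3)), A ⊆ κ₀ → B ⊆ κ₀ →
          MeasurableSet A → MeasurableSet B → μH[2] A = μH[2] B →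
          volume (φ '' A) = volume (φ '' B)) ∧
        (∀ A' B' : Set (EuclideanSpace ℝ (Fin 2)), A' ⊆ φ '' κ₀ → B' ⊆ φ '' κ₀ →
          MeasurableSet A' → MeasurableSet B' → volume A' = volume B' →
          μH[2] (ψ '' A') = μH[2] (ψ '' B'))) := by
  rintro ⟨U, V, φ, ψ, -, -, -, hφU, -, hφc, hψc, hψφ, -, hgeo, -, κ, ⟨v, c, hv, -, hc1, rfl⟩, -,
    hκU, harea, -⟩
  have hκ : sphericalCap v (max c 0) ⊆ {p : EuclideanSpace ℝ (Fin 3) |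
      p ∈ sphere (0 : EuclideanSpace ℝ (Fin 3)) 1 ∧ c < ⟪p, v⟫} := fun p hp =>
    ⟨by simpa using hp.1, (le_max_left c 0).trans_lt hp.2⟩
  have hU : sphericalCap v (max c 0) ⊆ U := (hκ.trans subset_closure).trans hκU
  have hc : 0 ≤ max c 0 := le_max_right c 0
  have hcont := hφc.mono hU
  have hinj : Set.InjOn φ (sphericalCap v (max c 0)) :=
    (Set.LeftInvOn.injOn (f₁' := ψ) hψφ).mono hU
  have hgeo' : IsGeodesicOn φ (sphericalCap v (max c 0)) := fun W hW σ hσ hσW =>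
    hgeo W hW σ hσ (hσW.trans (Set.inter_subset_inter_left _ hU))
  have hmeas : ∀ x ∈ sphericalCap v (max c 0), ∀ y ∈ sphericalCap v (max c 0),
      ∀ z ∈ sphericalCap v (max c 0), MeasurableSet (sphericalTriangle x y z) := by
    intro x hx y hy z hz
    have hT := (sphericalTriangle_subset_sphericalCap hc hx hy hz).trans hU
    have himg := hgeo'.image_sphericalTriangle hc hcont hinj hx hy hz
    have hψ : ψ '' (φ '' sphericalTriangle x y z) = sphericalTriangle x y z :=
      (Set.LeftInvOn.mono hψφ hT).image_image
    have hV : φ '' sphericalTriangle x y z ⊆ V := hφU ▸ Set.image_mono hT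
    rw [← hψ]
    refine (IsCompact.image_of_continuousOn ?_ (hψc.mono hV)).measurableSet
    rw [himg]
    exact (Set.toFinite _).isCompact_convexHull ℝ
  refine not_forall_map_normalize_add_eq_midpoint hv hc (max_lt hc1 one_pos) hinj
    fun x hx y hy => hgeo'.map_normalize_add hc hcont hinj ?_ hx hy
  intro x y z x' y' z' hx hy hz hx' hy' hz'
  exact harea _ _ ((sphericalTriangle_subset_sphericalCap hc hx hy hz).trans hκ)
    ((sphericalTriangle_subset_sphericalCap hc hx' hy' hz').trans hκ)
    (hmeas x hx y hy z hz) (hmeas x' hx' y' hy' z' hz')
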